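/- For every integer k ≥ 1, setting r = 1/2^k, and for every integer n > 2^k: u_Opt(n,r) ≥ (r·n)^{1/(2r) − 1}. -/

import Mathlib

namespace TQ

/-- A decision tree: internal nodes are labeled by questions (subsets of `α`,
with the two children corresponding to Yes/No), leaves by elements of `α`. -/
inductive DTree (α : Type) where
  | leaf (x : α) : DTree α
  | node (q : Finset α) (yes no : DTree α) : DTree α

namespace DTree

variable {α : Type} [DecidableEq α]

/-- The list of leaf labels of a decision tree. -/
def leaves : DTree α → List α
  | .leaf x => [x]
  | .node _ t f => leaves t ++ leaves f

/-- The set of questions appearing at internal nodes. -/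
def questions : DTree α → Set (Finset α)
  | .leaf _ => ∅
  | .node q t f => insert q (questions t ∪ questions f)

/-- Follow the path of `x` (Yes-edge iff `x` belongs to the question);
returns `some d` iff the path ends at a leaf labeled `x`, at depth `d`. -/
def find? : DTree α → α → Option ℕ
  | .leaf y, x => if y = x then some 0 else none
  | .node q t f, x => (if x ∈ q then find? t x else find? f x).map (· + 1)

/-- The depth of the leaf labeled `x` (junk value `0` if the path of `x`
does not end at a leaf labeled `x`). -/
def depth (T : DTree α) (x : α) : ℕ := (T.find? x).getD 0

end DTree

variable {α : Type} [Fintype α] [DecidableEq α]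

/-- `μ` is a probability distribution on `α`. -/
def IsDistribution (μ : α → ℝ) : Prop := (∀ x, 0 ≤ μ x) ∧ ∑ x, μ x = 1

/-- `T` is valid for `μ`: its leaves are distinct, the set of leaf labels is the
support of `μ`, and for every `x` in the support the path of `x` ends at the
leaf labeled `x`. -/
structure IsValid (T : DTree α) (μ : α → ℝ) : Prop where
  nodup : T.leaves.Nodup
  mem_leaves : ∀ x, x ∈ T.leaves ↔ μ x ≠ 0
  finds : ∀ x, μ x ≠ 0 → T.find? x = some (T.depth x)

/-- The cost of `T` on `μ`: the average depth `∑ x, μ(x) · T(x)`. -/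
noncomputable def cost (T : DTree α) (μ : α → ℝ) : ℝ := ∑ x, μ x * (T.depth x : ℝ)

/-- All questions of `T` belong to `Q`. -/
def UsesQuestions (T : DTree α) (Q : Set (Finset α)) : Prop := T.questions ⊆ Q

/-- `Opt(μ)`: the optimal cost over all decision trees valid for `μ`. -/
noncomputable def OptCost (μ : α → ℝ) : ℝ :=
  sInf { c | ∃ T : DTree α, IsValid T μ ∧ c = cost T μ }

/-- `c_Q(μ)`: the optimal cost over decision trees valid for `μ`
using only questions from `Q`. -/
noncomputable def cQ (Q : Set (Finset α)) (μ : α → ℝ) : ℝ :=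
  sInf { c | ∃ T : DTree α, IsValid T μ ∧ UsesQuestions T Q ∧ c = cost T μ }

/-- The base-2 (Shannon) entropy of `μ`. (Note `Real.logb 2 0 = 0`.) -/
noncomputable def entropy (μ : α → ℝ) : ℝ := ∑ x, -(μ x * Real.logb 2 (μ x))

/-- `Q` achieves prolixity `r`: for every distribution there is a valid tree using
only questions from `Q` of cost at most `Opt(μ) + r`. -/
def AchievesProlixity {n : ℕ} (Q : Finset (Finset (Fin n))) (r : ℝ) : Prop :=
  ∀ μ : Fin n → ℝ, IsDistribution μ →
    ∃ T : DTree (Fin n), IsValid T μ ∧ UsesQuestions T ↑Q ∧ cost T μ ≤ OptCost μ + r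

/-- `Q` achieves redundancy `r`: for every distribution there is a valid tree using
only questions from `Q` of cost at most `H(μ) + r`. -/
def AchievesRedundancy {n : ℕ} (Q : Finset (Finset (Fin n))) (r : ℝ) : Prop :=
  ∀ μ : Fin n → ℝ, IsDistribution μ →
    ∃ T : DTree (Fin n), IsValid T μ ∧ UsesQuestions T ↑Q ∧ cost T μ ≤ entropy μ + r

/-- `u_Opt(n,r)`: the minimum cardinality of a set of questions achieving prolixity `r`. -/
noncomputable def uOpt (n : ℕ) (r : ℝ) : ℕ :=
  sInf { k | ∃ Q : Finset (Finset (Fin n)), Q.card = k ∧ AchievesProlixity Q r }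

/-- `u_H(n,r)`: the minimum cardinality of a set of questions achieving redundancy `r`. -/
noncomputable def uH (n : ℕ) (r : ℝ) : ℕ :=
  sInf { k | ∃ Q : Finset (Finset (Fin n)), Q.card = k ∧ AchievesRedundancy Q r }

end TQ

namespace TQ

section trees
variable {α : Type} [DecidableEq α]

def Correct (T : DTree α) : Prop :=
  T.leaves.Nodup ∧ ∀ x ∈ T.leaves, ∃ d, T.find? x = some d

def cnt (S : Finset α) : DTree α → ℕ
  | .leaf x => if x ∈ S then 1 else 0
  | .node _ t f => cnt S t + cnt S f

def wt (S : Finset α) : DTree α → ℕ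
  | .leaf _ => 0
  | .node _ t f => (cnt S t + cnt S f) + (wt S t + wt S f)

lemma wt_g (S : Finset α) (T : DTree α) : ∀ j : ℕ, (j + 1) * cnt S T ≤ wt S T + 2 ^ j := by
  induction T with
  | leaf x =>
    intro j
    have : j < 2 ^ j := Nat.lt_two_pow_self
    simp only [cnt, wt]
    split_ifs <;> omega
  | node q t f iht ihf =>
    intro j
    simp only [cnt, wt]
    cases j with
    | zero => omega
    | succ j =>
      have h1 := iht j
      have h2 := ihf j
      rw [pow_succ]
      nlinarith

lemma wt_f (S : Finset α) (T : DTree α) (h : ∃ x ∈ T.leaves, x ∉ S) :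
    ∀ j : ℕ, (j + 1) * cnt S T + 1 ≤ wt S T + 2 ^ j := by
  induction T with
  | leaf x =>
    intro j
    have : 0 < 2 ^ j := by positivity
    obtain ⟨y, hy, hyS⟩ := h
    simp only [DTree.leaves, List.mem_singleton] at hy
    subst hy
    simp only [cnt, wt, hyS, if_false]
    omega
  | node q t f iht ihf =>
    intro j
    simp only [cnt, wt]
    cases j with
    | zero => omega
    | succ j =>
      obtain ⟨y, hy, hyS⟩ := h
      simp only [DTree.leaves, List.mem_append] at hy
      rw [pow_succ]
      rcases hy with hy | hy
      · have h1 := iht ⟨y, hy, hyS⟩ j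
        have h2 := wt_g S f j
        nlinarith
      · have h1 := wt_g S t j
        have h2 := ihf ⟨y, hy, hyS⟩ j
        nlinarith

lemma mem_of_find (T : DTree α) (x : α) : ∀ d, T.find? x = some d → x ∈ T.leaves := by
  induction T with
  | leaf y =>
    intro d h
    simp only [DTree.find?] at h
    split_ifs at h with h1
    simp [DTree.leaves, h1]
  | node q t f iht ihf =>
    intro d h
    simp only [DTree.find?, Option.map_eq_some_iff] at h
    obtain ⟨e, he, -⟩ := h
    simp only [DTree.leaves, List.mem_append]
    split_ifs at he
    · exact Or.inl (iht e he)
    · exact Or.inr (ihf e he)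

lemma Correct.mem_q {q : Finset α} {t f : DTree α} (h : Correct (.node q t f)) {x : α}
    (hx : x ∈ t.leaves) : x ∈ q := by
  by_contra hq
  obtain ⟨d, hd⟩ := h.2 x (by simp [DTree.leaves, hx])
  simp only [DTree.find?, hq, if_false, Option.map_eq_some_iff] at hd
  obtain ⟨e, he, -⟩ := hd
  have := mem_of_find f x e he
  have h1 := h.1
  simp only [DTree.leaves] at h1
  exact List.disjoint_of_nodup_append h1 hx this

lemma Correct.not_mem_q {q : Finset α} {t f : DTree α} (h : Correct (.node q t f)) {x : α}
    (hx : x ∈ f.leaves) : x ∉ q := by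
  intro hq
  obtain ⟨d, hd⟩ := h.2 x (by simp [DTree.leaves, hx])
  simp only [DTree.find?, hq, if_true, Option.map_eq_some_iff] at hd
  obtain ⟨e, he, -⟩ := hd
  have := mem_of_find t x e he
  have h1 := h.1
  simp only [DTree.leaves] at h1
  exact List.disjoint_of_nodup_append h1 this hx

lemma Correct.find_left {q : Finset α} {t f : DTree α} (h : Correct (.node q t f)) {x : α}
    (hx : x ∈ t.leaves) : ∃ d, t.find? x = some d ∧ (DTree.node q t f).find? x = some (d + 1) := by
  have hq := h.mem_q hx
  obtain ⟨d, hd⟩ := h.2 x (by simp [DTree.leaves, hx])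
  simp only [DTree.find?, hq, if_true, Option.map_eq_some_iff] at hd ⊢
  obtain ⟨e, he, -⟩ := hd
  exact ⟨e, he, e, he, rfl⟩

lemma Correct.find_right {q : Finset α} {t f : DTree α} (h : Correct (.node q t f)) {x : α}
    (hx : x ∈ f.leaves) : ∃ d, f.find? x = some d ∧ (DTree.node q t f).find? x = some (d + 1) := by
  have hq := h.not_mem_q hx
  obtain ⟨d, hd⟩ := h.2 x (by simp [DTree.leaves, hx])
  simp only [DTree.find?, hq, if_false, Option.map_eq_some_iff] at hd ⊢
  obtain ⟨e, he, -⟩ := hd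
  exact ⟨e, he, e, he, rfl⟩

lemma Correct.left {q : Finset α} {t f : DTree α} (h : Correct (.node q t f)) : Correct t := by
  refine ⟨?_, fun x hx => ?_⟩
  · have := h.1
    simp only [DTree.leaves] at this
    exact this.of_append_left
  · obtain ⟨d, hd, -⟩ := h.find_left hx
    exact ⟨d, hd⟩

lemma Correct.right {q : Finset α} {t f : DTree α} (h : Correct (.node q t f)) : Correct f := by
  refine ⟨?_, fun x hx => ?_⟩
  · have := h.1
    simp only [DTree.leaves] at this
    exact this.of_append_right
  · obtain ⟨d, hd, -⟩ := h.find_right hx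
    exact ⟨d, hd⟩

lemma Correct.depth_left {q : Finset α} {t f : DTree α} (h : Correct (.node q t f)) {x : α}
    (hx : x ∈ t.leaves) : (DTree.node q t f).depth x = t.depth x + 1 := by
  obtain ⟨d, hd, hd'⟩ := h.find_left hx
  simp [DTree.depth, hd, hd']

lemma Correct.depth_right {q : Finset α} {t f : DTree α} (h : Correct (.node q t f)) {x : α}
    (hx : x ∈ f.leaves) : (DTree.node q t f).depth x = f.depth x + 1 := by
  obtain ⟨d, hd, hd'⟩ := h.find_right hx
  simp [DTree.depth, hd, hd']

lemma cnt_eq (S : Finset α) (T : DTree α) :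
    (T.leaves.map (fun x => if x ∈ S then 1 else 0)).sum = cnt S T := by
  induction T with
  | leaf x => simp [DTree.leaves, cnt]
  | node q t f iht ihf => simp [DTree.leaves, cnt, List.sum_append, ← iht, ← ihf]

lemma wt_eq (S : Finset α) (T : DTree α) (h : Correct T) :
    (T.leaves.map (fun x => if x ∈ S then T.depth x else 0)).sum = wt S T := by
  induction T with
  | leaf x => simp [DTree.leaves, wt, DTree.depth, DTree.find?]
  | node q t f iht ihf =>
    have h1 : (t.leaves.map (fun x => if x ∈ S then (DTree.node q t f).depth x else 0)).sum
        = (t.leaves.map (fun x => (if x ∈ S then 1 else 0) + if x ∈ S then t.depth x else 0)).sum := by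
      congr 1
      apply List.map_congr_left
      intro x hx
      rw [h.depth_left hx]
      split_ifs <;> omega
    have h2 : (f.leaves.map (fun x => if x ∈ S then (DTree.node q t f).depth x else 0)).sum
        = (f.leaves.map (fun x => (if x ∈ S then 1 else 0) + if x ∈ S then f.depth x else 0)).sum := by
      congr 1
      apply List.map_congr_left
      intro x hx
      rw [h.depth_right hx]
      split_ifs <;> omega
    simp only [DTree.leaves, wt, List.map_append, List.sum_append, h1, h2, List.sum_map_add,
      iht h.left, ihf h.right, cnt_eq]
    omega

lemma cnt_card (S : Finset α) (T : DTree α) (h : T.leaves.Nodup) :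
    cnt S T = (T.leaves.toFinset.filter (· ∈ S)).card := by
  rw [← cnt_eq, ← List.sum_toFinset _ h, Finset.card_filter]

lemma correct_node {t f : DTree α} (ht : Correct t) (hf : Correct f)
    (hd : Disjoint t.leaves.toFinset f.leaves.toFinset) :
    Correct (.node t.leaves.toFinset t f) := by
  refine ⟨?_, ?_⟩
  · simp only [DTree.leaves]
    refine List.Nodup.append ht.1 hf.1 ?_
    exact List.disjoint_toFinset_iff_disjoint.mp hd
  · intro x hx
    simp only [DTree.leaves, List.mem_append] at hx
    by_cases hxt : x ∈ t.leaves
    · obtain ⟨d, hd⟩ := ht.2 x hxt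
      exact ⟨d + 1, by simp [DTree.find?, hxt, hd]⟩
    · obtain ⟨d, hd⟩ := hf.2 x (hx.resolve_left hxt)
      exact ⟨d + 1, by simp [DTree.find?, hxt, hd]⟩

lemma correct_leaf (x : α) : Correct (DTree.leaf x) := by
  simp [Correct, DTree.leaves, DTree.find?]

lemma exists_chain (A : Finset α) (hA : A.Nonempty) :
    ∃ T : DTree α, Correct T ∧ T.leaves.toFinset = A ∧ ∀ x ∈ A, T.depth x ≤ A.card := by
  induction hA using Finset.Nonempty.cons_induction with
  | singleton a =>
    refine ⟨.leaf a, correct_leaf a, by simp [DTree.leaves], ?_⟩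
    simp [DTree.depth, DTree.find?]
  | cons a s ha hs ih =>
    obtain ⟨T, hT, hl, hdep⟩ := ih
    have hc : Correct (.node (DTree.leaf a).leaves.toFinset (DTree.leaf a) T) := by
      apply correct_node (correct_leaf a) hT
      rw [hl]
      simp [DTree.leaves, ha]
    refine ⟨_, hc, ?_, ?_⟩
    · ext x
      have hx : x ∈ T.leaves ↔ x ∈ s := by rw [← hl]; simp
      simp [DTree.leaves, hx]
    · intro x hx
      rw [Finset.card_cons]
      rcases Finset.mem_cons.mp hx with rfl | hx
      · rw [hc.depth_left (by simp [DTree.leaves])]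
        simp [DTree.depth, DTree.find?]
      · have h1 := hdep x hx
        rw [hc.depth_right (by rw [← List.mem_toFinset, hl]; exact hx)]
        omega

lemma exists_big (k : ℕ) : ∀ (S : Finset α) (R : DTree α), S.card + 1 = 2 ^ k → Correct R →
    Disjoint S R.leaves.toFinset →
    ∃ T : DTree α, Correct T ∧ T.leaves.toFinset = S ∪ R.leaves.toFinset ∧
      (∀ x ∈ S, T.depth x ≤ k) ∧ ∀ x ∈ R.leaves, T.depth x ≤ k + R.depth x := by
  induction k with
  | zero =>
    intro S R hS hR _
    have : S = ∅ := by
      rw [← Finset.card_eq_zero]; simpa using hS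
    subst this
    exact ⟨R, hR, by simp, by simp, by simp⟩
  | succ k ih =>
    intro S R hS hR hd
    have hpos : 0 < 2 ^ k := by positivity
    rw [pow_succ] at hS
    obtain ⟨S2, hS2, hS2c⟩ := Finset.exists_subset_card_eq (s := S) (n := 2 ^ k) (by omega)
    obtain ⟨x, hx⟩ : S2.Nonempty := by rw [← Finset.card_pos]; omega
    have hS1c : (S \ S2).card + 1 = 2 ^ k := by
      rw [Finset.card_sdiff_of_subset hS2]; omega
    obtain ⟨T1, hT1, hl1, hs1, hr1⟩ := ih (S \ S2) R hS1c hR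
      (Finset.disjoint_of_subset_left Finset.sdiff_subset hd)
    obtain ⟨T2, hT2, hl2, hs2, hr2⟩ := ih (S2.erase x) (.leaf x)
      (by rw [Finset.card_erase_of_mem hx]; omega) (correct_leaf x) (by simp [DTree.leaves])
    have hl2' : T2.leaves.toFinset = S2 := by
      rw [hl2]; ext y; simp only [DTree.leaves, List.toFinset_cons, List.toFinset_nil, Finset.mem_union, Finset.mem_erase, insert_empty_eq, Finset.mem_singleton]
      constructor
      · rintro (h | rfl)
        · exact h.2
        · exact hx
      · intro h
        by_cases hyx : y = x
        · exact Or.inr hyx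
        · exact Or.inl ⟨hyx, h⟩
    have hs2' : ∀ y ∈ S2, T2.depth y ≤ k := by
      intro y hy
      by_cases hyx : y = x
      · subst hyx
        have := hr2 y (by simp [DTree.leaves])
        simpa [DTree.depth, DTree.find?] using this
      · exact hs2 y (Finset.mem_erase.mpr ⟨hyx, hy⟩)
    have hc := correct_node hT1 hT2 (by
      rw [hl1, hl2', Finset.disjoint_union_left]
      exact ⟨Finset.sdiff_disjoint, (Finset.disjoint_of_subset_left hS2 hd).symm⟩)
    refine ⟨_, hc, ?_, ?_, ?_⟩
    · simp only [DTree.leaves, List.toFinset_append, hl1, hl2']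
      ext y
      have := @hS2 y
      simp only [Finset.mem_union, Finset.mem_sdiff]
      tauto
    · intro y hy
      by_cases hy2 : y ∈ S2
      · rw [hc.depth_right (by rw [← List.mem_toFinset, hl2']; exact hy2)]
        have := hs2' y hy2
        omega
      · rw [hc.depth_left (by rw [← List.mem_toFinset, hl1]; simp [hy, hy2])]
        have := hs1 y (by simp [hy, hy2])
        omega
    · intro y hy
      rw [hc.depth_left (by rw [← List.mem_toFinset, hl1]; simp [hy])]
      have := hr1 y hy
      omega

end trees

section dist
variable {α : Type} [Fintype α] [DecidableEq α]

lemma IsValid.correct {T : DTree α} {μ : α → ℝ} (h : IsValid T μ) : Correct T :=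
  ⟨h.nodup, fun x hx => ⟨_, h.finds x ((h.mem_leaves x).1 hx)⟩⟩

lemma Correct.valid {T : DTree α} {μ : α → ℝ} (h : Correct T)
    (hm : ∀ x, x ∈ T.leaves ↔ μ x ≠ 0) : IsValid T μ := by
  refine ⟨h.1, hm, fun x hx => ?_⟩
  obtain ⟨d, hd⟩ := h.2 x ((hm x).2 hx)
  simp [DTree.depth, hd]

lemma optCost_le {μ : α → ℝ} (hμ : ∀ x, 0 ≤ μ x) {T : DTree α} (h : IsValid T μ) :
    OptCost μ ≤ cost T μ := by
  apply csInf_le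
  · refine ⟨0, ?_⟩
    rintro c ⟨T, -, rfl⟩
    exact Finset.sum_nonneg fun x _ => mul_nonneg (hμ x) (Nat.cast_nonneg _)
  · exact ⟨T, h, rfl⟩

lemma exists_near {μ : α → ℝ} (hμ : IsDistribution μ) {r : ℝ} (hr : 0 < r) :
    ∃ T : DTree α, IsValid T μ ∧ cost T μ ≤ OptCost μ + r := by
  have hne : (Finset.univ.filter (fun x => μ x ≠ 0)).Nonempty := by
    by_contra h
    rw [Finset.not_nonempty_iff_eq_empty, Finset.filter_eq_empty_iff] at h
    have h2 := hμ.2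
    rw [Finset.sum_eq_zero (fun x hx => by simpa using h hx)] at h2
    exact zero_ne_one h2
  obtain ⟨T, hT, hl, -⟩ := exists_chain _ hne
  have hv : IsValid T μ := hT.valid (fun x => by rw [← List.mem_toFinset, hl]; simp)
  obtain ⟨c, ⟨T', hT', rfl⟩, hc⟩ := exists_lt_of_csInf_lt (s := { c | ∃ T : DTree α, IsValid T μ ∧ c = cost T μ })
    ⟨_, T, hv, rfl⟩ (lt_add_of_pos_right (OptCost μ) hr)
  exact ⟨T', hT', hc.le⟩

end dist

lemma root_lemma {n : ℕ} (k : ℕ) (S : Finset (Fin n)) (t : Fin n) (ht : t ∉ S)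
    (hS : S.card + 1 = 2 ^ (k + 1)) (T : DTree (Fin n)) (hT : Correct T)
    (hall : ∀ x, x ∈ T.leaves) (hsum : ∑ x ∈ S, T.depth x ≤ (k + 1) * S.card) :
    ∃ q ∈ T.questions, (if t ∈ q then qᶜ else q) ⊆ S ∧
      2 ^ k ≤ (if t ∈ q then qᶜ else q).card + 1 := by
  have hw : wt S T = ∑ x ∈ S, T.depth x := by
    rw [← wt_eq S T hT, ← List.sum_toFinset _ hT.1]
    have : T.leaves.toFinset = Finset.univ := by ext x; simp [hall x]
    rw [this, ← Finset.sum_filter]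
    simp
  have hc : cnt S T = S.card := by
    rw [cnt_card S T hT.1]
    congr 1
    ext x; simp [hall x]
  rw [← hw] at hsum
  have hpos : 0 < 2 ^ k := by positivity
  rw [pow_succ] at hS
  cases T with
  | leaf x =>
    exfalso
    obtain ⟨y, hy⟩ : S.Nonempty := by rw [← Finset.card_pos]; omega
    have h1 := hall t
    have h2 := hall y
    simp only [DTree.leaves, List.mem_singleton] at h1 h2
    subst h1; subst h2; exact ht hy
  | node q y z =>
    have hqy : ∀ x, x ∈ y.leaves ↔ x ∈ q := by
      intro x
      refine ⟨hT.mem_q, fun hx => ?_⟩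
      have := hall x
      simp only [DTree.leaves, List.mem_append] at this
      exact this.resolve_right (fun h => hT.not_mem_q h hx)
    have hqz : ∀ x, x ∈ z.leaves ↔ x ∉ q := by
      intro x
      refine ⟨hT.not_mem_q, fun hx => ?_⟩
      have := hall x
      simp only [DTree.leaves, List.mem_append] at this
      exact this.resolve_left (fun h => hx (hT.mem_q h))
    simp only [cnt, wt] at hsum hc
    refine ⟨q, by simp [DTree.questions], ?_⟩
    by_cases hy : ∃ x ∈ y.leaves, x ∉ S
    · by_cases hz : ∃ x ∈ z.leaves, x ∉ S
      · exfalso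
        have h1 := wt_f S y hy k
        have h2 := wt_f S z hz k
        nlinarith
      · push Not at hz
        have htq : t ∈ q := by
          by_contra h; exact ht (hz t ((hqz t).2 h))
        have hsub : qᶜ ⊆ S := by
          intro x hx; exact hz x ((hqz x).2 (by simpa using hx))
        simp only [htq, if_true]
        refine ⟨hsub, ?_⟩
        have hcz : cnt S z = qᶜ.card := by
          rw [cnt_card S z hT.right.1]
          congr 1
          ext x
          simp only [Finset.mem_filter, List.mem_toFinset, hqz, Finset.mem_compl]
          exact ⟨fun h => h.1, fun h => ⟨h, hsub (by simpa using h)⟩⟩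
        rw [← hcz]
        have h1 := wt_f S y hy (k + 1)
        have h2 := wt_g S z k
        rw [pow_succ] at h1
        nlinarith
    · push Not at hy
      have htq : t ∉ q := by
        intro h; exact ht (hy t ((hqy t).2 h))
      have hsub : q ⊆ S := by
        intro x hx; exact hy x ((hqy x).2 hx)
      simp only [htq, if_false]
      refine ⟨hsub, ?_⟩
      have hcy : cnt S y = q.card := by
        rw [cnt_card S y hT.left.1]
        congr 1
        ext x
        simp only [Finset.mem_filter, List.mem_toFinset, hqy]
        exact ⟨fun h => h.1, fun h => ⟨h, hsub h⟩⟩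
      rw [← hcy]
      have h1 := wt_f S z ⟨t, (hqz t).2 htq, ht⟩ (k + 1)
      have h2 := wt_g S y k
      rw [pow_succ] at h1
      nlinarith

lemma key_lemma {n : ℕ} (k : ℕ) (r : ℝ) (hr : r = 1 / 2 ^ (k + 1)) (Q : Finset (Finset (Fin n)))
    (hQ : AchievesProlixity Q r) (S : Finset (Fin n)) (t : Fin n) (ht : t ∉ S)
    (hS : S.card + 1 = 2 ^ (k + 1)) :
    ∃ q ∈ Q, (if t ∈ q then qᶜ else q) ⊆ S ∧
      2 ^ k ≤ (if t ∈ q then qᶜ else q).card + 1 := by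
  classical
  have hr0 : 0 < r := by rw [hr]; positivity
  have hpos : 0 < 2 ^ k := by positivity
  have hM0 : 0 < S.card := by rw [pow_succ] at hS; omega
  obtain ⟨M, hM⟩ : ∃ M : ℝ, M = S.card := ⟨_, rfl⟩
  obtain ⟨m, hm⟩ : ∃ m : ℝ, m = (Sᶜ.card : ℝ) := ⟨_, rfl⟩
  have hMpos : 1 ≤ M := by rw [hM]; exact_mod_cast hM0
  have hm0 : 0 ≤ m := by rw [hm]; positivity
  have hrM : r * M = 1 - r := by
    have : M + 1 = 2 ^ (k + 1) := by rw [hM]; exact_mod_cast hS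
    have h2 : r * (M + 1) = 1 := by rw [hr, this]; field_simp
    linarith
  have hr1 : r < 1 := by nlinarith
  obtain ⟨K, hK⟩ : ∃ K : ℝ, K = (k : ℝ) + 1 := ⟨_, rfl⟩
  have hK0 : 1 ≤ K := by rw [hK]; linarith [Nat.cast_nonneg (α := ℝ) k]
  obtain ⟨B, hB⟩ : ∃ B : ℝ, B = m * (K * M + 1) + m * m * M := ⟨_, rfl⟩
  have hmB : m ≤ B := by
    have : 0 ≤ m * (K * M) := by positivity
    have : 0 ≤ m * m * M := by positivity
    nlinarith
  have hB0 : 0 ≤ B := hm0.trans hmB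
  obtain ⟨ε, hε⟩ : ∃ ε : ℝ, ε = r / (B + 1) := ⟨_, rfl⟩
  have hε0 : 0 < ε := by rw [hε]; positivity
  have hεB : ε * B < r := by
    have : ε * (B + 1) = r := by rw [hε]; field_simp
    linarith
  obtain ⟨p, hp⟩ : ∃ p : ℝ, p = (1 - m * ε) / M := ⟨_, rfl⟩
  have hmε : m * ε < 1 := by nlinarith
  have hp0 : 0 < p := by rw [hp]; apply div_pos <;> linarith
  have hpM : M * p = 1 - m * ε := by rw [hp]; field_simp
  have hsplit : ∀ g : Fin n → ℝ, ∑ x, (if x ∈ S then p else ε) * g x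
      = p * ∑ x ∈ S, g x + ε * ∑ x ∈ Sᶜ, g x := by
    intro g
    rw [← Finset.sum_add_sum_compl S, Finset.mul_sum, Finset.mul_sum]
    congr 1
    · exact Finset.sum_congr rfl fun x hx => by rw [if_pos hx]
    · exact Finset.sum_congr rfl fun x hx => by rw [if_neg (by simpa using hx)]
  set μ : Fin n → ℝ := fun x => if x ∈ S then p else ε with hμ
  have hμpos : ∀ x, 0 < μ x := by
    intro x; simp only [hμ]; split_ifs <;> assumption
  have hdist : IsDistribution μ := by
    refine ⟨fun x => (hμpos x).le, ?_⟩
    have := hsplit (fun _ => 1)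
    simp only [mul_one, Finset.sum_const, nsmul_eq_mul, ← hM, ← hm] at this
    rw [hμ, this]; linarith
  -- upper bound on Opt
  have hopt : OptCost μ ≤ K + m * m * ε := by
    obtain ⟨R, hR, hRl, hRd⟩ := exists_chain Sᶜ ⟨t, by simpa using ht⟩
    obtain ⟨T, hT, hTl, hTs, hTr⟩ := exists_big (k + 1) S R hS hR
      (by rw [hRl]; exact disjoint_compl_right)
    have hv : IsValid T μ := hT.valid (fun x => by
      rw [← List.mem_toFinset, hTl, hRl]
      simp [(hμpos x).ne', em])
    refine (optCost_le hdist.1 hv).trans ?_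
    unfold cost
    rw [hμ, hsplit]
    have h1 : ∑ x ∈ S, (T.depth x : ℝ) ≤ M * K := by
      rw [hM, ← nsmul_eq_mul]
      apply Finset.sum_le_card_nsmul
      intro x hx
      rw [hK]; exact_mod_cast hTs x hx
    have h2 : ∑ x ∈ Sᶜ, (T.depth x : ℝ) ≤ m * (K + m) := by
      nth_rewrite 1 [hm]
      rw [← nsmul_eq_mul]
      apply Finset.sum_le_card_nsmul
      intro x hx
      rw [hK, hm]
      have h3 := hTr x (by rw [← List.mem_toFinset, hRl]; exact hx)
      have h4 := hRd x hx
      have h5 : T.depth x ≤ (k + 1) + Sᶜ.card := by omega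
      exact_mod_cast h5
    calc p * ∑ x ∈ S, (T.depth x : ℝ) + ε * ∑ x ∈ Sᶜ, (T.depth x : ℝ)
        ≤ p * (M * K) + ε * (m * (K + m)) := by gcongr
      _ = (M * p) * K + ε * (m * (K + m)) := by ring
      _ = K + m * m * ε := by rw [hpM]; ring
  obtain ⟨T, hv, hu, hcost⟩ := hQ μ hdist
  have hsum : ∑ x ∈ S, T.depth x ≤ (k + 1) * S.card := by
    by_contra hcon
    have hD : K * M + 1 ≤ ∑ x ∈ S, (T.depth x : ℝ) := by
      rw [hK, hM]
      have : (k + 1) * S.card + 1 ≤ ∑ x ∈ S, T.depth x := by omega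
      exact_mod_cast this
    have h1 : p * (K * M + 1) ≤ K + m * m * ε + r := by
      calc p * (K * M + 1) ≤ p * ∑ x ∈ S, (T.depth x : ℝ) := by gcongr
        _ ≤ p * ∑ x ∈ S, (T.depth x : ℝ) + ε * ∑ x ∈ Sᶜ, (T.depth x : ℝ) := by
          have : 0 ≤ ε * ∑ x ∈ Sᶜ, (T.depth x : ℝ) := by positivity
          linarith
        _ = cost T μ := by unfold cost; rw [hμ, hsplit]
        _ ≤ _ := by linarith
    have h2 : M * (p * (K * M + 1)) ≤ M * (K + m * m * ε + r) := by gcongr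
    have h3 : M * (p * (K * M + 1)) = (1 - m * ε) * (K * M + 1) := by rw [← hpM]; ring
    rw [h3] at h2
    rw [hB] at hεB
    nlinarith
  obtain ⟨q, hq, h⟩ := root_lemma k S t ht hS T hv.correct
    (fun x => (hv.mem_leaves x).2 (hμpos x).ne') hsum
  exact ⟨q, by simpa using hu hq, h⟩

lemma count_lemma {α : Type} [DecidableEq α] (U : Finset α) (M s : ℕ) (hsM : s ≤ M)
    (hMU : M ≤ U.card)
    {ι : Type} (Q : Finset ι) (A : ι → Finset α)
    (h : ∀ S ⊆ U, S.card = M → ∃ q ∈ Q, A q ⊆ S ∧ s ≤ (A q).card) :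
    U.card.choose s ≤ Q.card * M.choose s := by
  classical
  have h1 : U.powersetCard M ⊆ Q.biUnion (fun q => (U.powersetCard M).filter
      (fun S => A q ⊆ S ∧ s ≤ (A q).card)) := by
    intro S hS
    obtain ⟨q, hq, hh⟩ := h S (Finset.mem_powersetCard.1 hS).1 (Finset.mem_powersetCard.1 hS).2
    simp only [Finset.mem_biUnion, Finset.mem_filter]
    exact ⟨q, hq, hS, hh⟩
  have h2 : ∀ q ∈ Q, ((U.powersetCard M).filter
      (fun S => A q ⊆ S ∧ s ≤ (A q).card)).card ≤ (U.card - s).choose (M - s) := by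
    intro q _
    by_cases hs : s ≤ (A q).card
    · obtain ⟨B, hB, hBc⟩ := Finset.exists_subset_card_eq hs
      by_cases hBU : B ⊆ U
      · rw [← hBc, ← Finset.card_sdiff_of_subset hBU, ← Finset.card_powersetCard]
        apply Finset.card_le_card_of_injOn (fun S => S \ B)
        · intro S hS
          simp only [Finset.coe_filter, Finset.mem_powersetCard, Set.mem_ofPred_eq] at hS
          simp only [Finset.mem_coe, Finset.mem_powersetCard]
          refine ⟨Finset.sdiff_subset_sdiff hS.1.1 (Finset.Subset.refl _), ?_⟩
          rw [Finset.card_sdiff_of_subset (hB.trans hS.2.1), hS.1.2]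
        · intro S hS S' hS' heq
          simp only [Finset.coe_filter, Finset.mem_powersetCard, Set.mem_ofPred_eq] at hS hS'
          simp only at heq
          rw [← Finset.sdiff_union_of_subset (hB.trans hS.2.1), heq,
            Finset.sdiff_union_of_subset (hB.trans hS'.2.1)]
      · rw [Finset.filter_false_of_mem]
        · simp
        · intro S hS hh
          exact hBU ((hB.trans hh.1).trans (Finset.mem_powersetCard.1 hS).1)
    · simp [hs]
  have h3 : U.card.choose M ≤ Q.card * (U.card - s).choose (M - s) := by
    rw [← Finset.card_powersetCard]
    exact (Finset.card_le_card h1).trans (Finset.card_biUnion_le_card_mul _ _ _ h2)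
  have h4 := Nat.choose_mul (n := U.card) (k := M) (s := s) hsM
  have h5 : 0 < (U.card - s).choose (M - s) := Nat.choose_pos (by omega)
  apply Nat.le_of_mul_le_mul_right _ h5
  rw [← h4]
  calc _ ≤ (Q.card * (U.card - s).choose (M - s)) * M.choose s := Nat.mul_le_mul_right _ h3
    _ = _ := by ring

lemma choose_ratio (N n : ℕ) (hN : 0 < N) (hn : N ≤ n) (s : ℕ) (hs : s ≤ N - 1) :
    ((n : ℝ) / N) ^ s * ((N - 1).choose s) ≤ (n - 1).choose s := by
  induction s with
  | zero => simp
  | succ s ih =>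
    have ih := ih (by omega)
    have e1 : ((N - 1).choose (s + 1) : ℝ) * (s + 1) = (N - 1).choose s * ((N : ℝ) - 1 - s) := by
      have := Nat.choose_succ_right_eq (N - 1) s
      have h2 : ((N - 1 - s : ℕ) : ℝ) = (N : ℝ) - 1 - s := by
        rw [Nat.cast_sub (by omega), Nat.cast_sub (by omega)]; simp
      rw [← h2]; exact_mod_cast this
    have e2 : ((n - 1).choose (s + 1) : ℝ) * (s + 1) = (n - 1).choose s * ((n : ℝ) - 1 - s) := by
      have := Nat.choose_succ_right_eq (n - 1) s
      have h2 : ((n - 1 - s : ℕ) : ℝ) = (n : ℝ) - 1 - s := by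
        rw [Nat.cast_sub (by omega), Nat.cast_sub (by omega)]; simp
      rw [← h2]; exact_mod_cast this
    have hN' : (0 : ℝ) < N := by exact_mod_cast hN
    have hnN : (N : ℝ) ≤ n := by exact_mod_cast hn
    have hsN : (s : ℝ) + 1 ≤ N := by
      have : s + 1 ≤ N := by omega
      exact_mod_cast this
    have hr : (n : ℝ) / N * ((N : ℝ) - 1 - s) ≤ (n : ℝ) - 1 - s := by
      rw [div_mul_eq_mul_div, div_le_iff₀ hN']
      nlinarith [Nat.cast_nonneg (α := ℝ) s]
    have hs1 : (0 : ℝ) < s + 1 := by positivity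
    apply le_of_mul_le_mul_right _ hs1
    rw [e2]
    calc ((n : ℝ) / N) ^ (s + 1) * ((N - 1).choose (s + 1)) * (s + 1)
        = ((n : ℝ) / N) ^ s * (n / N) * (((N - 1).choose (s + 1)) * (s + 1)) := by ring
      _ = (((n : ℝ) / N) ^ s * (N - 1).choose s) * (n / N * ((N : ℝ) - 1 - s)) := by rw [e1]; ring
      _ ≤ (n - 1).choose s * ((n : ℝ) - 1 - s) := by
          apply mul_le_mul ih hr _ (by positivity)
          apply mul_nonneg (by positivity); linarith

end TQ


open TQ in
/-- For `r = 1/2^k` (integer `k ≥ 1`) and `n > 2^k`: `u_Opt(n,r) ≥ (rn)^{1/(2r)−1}`. -/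
theorem uOpt_prolixity_lower (k : ℕ) (hk : 1 ≤ k) (r : ℝ) (hr : r = 1 / 2 ^ k)
    (n : ℕ) (hn : 2 ^ k < n) :
    (r * n) ^ ((1 : ℝ) / (2 * r) - 1) ≤ (uOpt n r : ℝ) := by
  obtain ⟨j, rfl⟩ : ∃ j, k = j + 1 := ⟨k - 1, by omega⟩
  have hr0 : 0 < r := by rw [hr]; positivity
  have hne : { k | ∃ Q : Finset (Finset (Fin n)), Q.card = k ∧ AchievesProlixity Q r }.Nonempty := by
    refine ⟨_, Finset.univ, rfl, fun μ hμ => ?_⟩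
    obtain ⟨T, hT, hc⟩ := exists_near hμ hr0
    exact ⟨T, hT, by simp [UsesQuestions], hc⟩
  obtain ⟨Q, hQc, hQ⟩ := Nat.sInf_mem hne
  have hQc' : uOpt n r = Q.card := hQc.symm
  rw [hQc']
  have hpos : 0 < 2 ^ j := by positivity
  have hpow : 2 ^ (j + 1) = 2 * 2 ^ j := by rw [pow_succ]; ring
  have hn0 : 0 < n := by omega
  let t : Fin n := ⟨0, hn0⟩
  have hU : (Finset.univ.erase t).card = n - 1 := by
    rw [Finset.card_erase_of_mem (Finset.mem_univ _)]; simp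
  have h1 := count_lemma (Finset.univ.erase t) (2 ^ (j + 1) - 1) (2 ^ j - 1) (by omega)
    (by rw [hU]; omega) Q (fun q => if t ∈ q then qᶜ else q) (by
      intro S hS hSc
      obtain ⟨q, hq, h, h'⟩ := key_lemma j r hr Q hQ S t
        (fun h => by simpa using hS h) (by omega)
      exact ⟨q, hq, h, by omega⟩)
  rw [hU] at h1
  have h2 := choose_ratio (2 ^ (j + 1)) n (by positivity) hn.le (2 ^ j - 1) (by omega)
  have he : (1 : ℝ) / (2 * r) - 1 = ((2 ^ j - 1 : ℕ) : ℝ) := by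
    rw [Nat.cast_sub hpos, hr, pow_succ]
    push_cast
    field_simp
  have hb : r * n = (n : ℝ) / ((2 ^ (j + 1) : ℕ) : ℝ) := by
    rw [hr]; push_cast; ring
  rw [he, Real.rpow_natCast, hb]
  have hc : (0 : ℝ) < ((2 ^ (j + 1) - 1).choose (2 ^ j - 1) : ℕ) := by
    exact_mod_cast Nat.choose_pos (by omega)
  apply le_of_mul_le_mul_right _ hc
  refine h2.trans ?_
  exact_mod_cast h1
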